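/- arXiv:2104.03359 — 3 statements merged into one kernel-verified Lean document; each statement's English description precedes it below -/
import Mathlib

section
/- Let G be a polysurface group (of any length n ≥ 1) and let A be a finite abelian group. Then every central extension φ : Γ → G of G by A becomes trivial after passing to a finite-index subgroup of G: there exists a subgroup W of G of finite index and a group homomorphism s : W → Γ with φ ∘ s equal to the inclusion of W into G. -/
open scoped commutatorElement in
/-- The single relator `[a₁,b₁]⋯[a_g,b_g]` of a genus-`g` surface group, in the free
group on generators `(i, true) = aᵢ` and `(i, false) = bᵢ`. -/
def surfaceRelator (g : ℕ) : FreeGroup (Fin g × Bool) :=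
  (List.ofFn fun i : Fin g =>
    ⁅FreeGroup.of (i, true), FreeGroup.of (i, false)⁆).prod

/-- The surface group of genus `g`, presented as
`⟨a₁,b₁,…,a_g,b_g ∣ [a₁,b₁]⋯[a_g,b_g]⟩`. -/
abbrev SurfaceGroup (g : ℕ) :=
  PresentedGroup ({surfaceRelator g} : Set (FreeGroup (Fin g × Bool)))

/-- A group is a surface group of genus `g` if it is isomorphic to `SurfaceGroup g`. -/
def IsSurfaceGroup (G : Type*) [Group G] (g : ℕ) : Prop :=
  Nonempty (G ≃* SurfaceGroup g)

/-- A group `G` is a polysurface group of length `n`: there is a filtration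
`⊥ = G₀ ≤ G₁ ≤ ⋯ ≤ G_n = G` by normal subgroups of `G` whose successive quotients
are surface groups of genus at least 2 (the quotient `G_{i+1}/G_i` is expressed by a
surjection `G_{i+1} →* SurfaceGroup g` with kernel `G_i`). -/
def IsPolysurface (G : Type*) [Group G] (n : ℕ) : Prop :=
  ∃ Gs : Fin (n + 1) → Subgroup G,
    Gs 0 = ⊥ ∧ Gs (Fin.last n) = ⊤ ∧ Monotone Gs ∧
    (∀ i, (Gs i).Normal) ∧
    ∀ i : Fin n, ∃ g : ℕ, 2 ≤ g ∧
      ∃ f : (Gs i.succ) →* SurfaceGroup g,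
        Function.Surjective f ∧ f.ker = (Gs i.castSucc).subgroupOf (Gs i.succ)

open scoped commutatorElement

/-- `D` is a crossed homomorphism for the action `ρ`. -/
def PSCrossed {F V : Type*} [Group F] [CommGroup V] (ρ : F →* MulAut V) (D : F → V) : Prop :=
  ∀ u w, D (u * w) = D u * ρ u (D w)

theorem PSCrossed.one {F V : Type*} [Group F] [CommGroup V] {ρ : F →* MulAut V} {D : F → V}
    (h : PSCrossed ρ D) : D 1 = 1 := by
  have := h 1 1
  simpa using this

theorem PSCrossed.inv {F V : Type*} [Group F] [CommGroup V] {ρ : F →* MulAut V} {D : F → V}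
    (h : PSCrossed ρ D) (u : F) : D u⁻¹ = (ρ u⁻¹ (D u))⁻¹ := by
  have := h u⁻¹ u
  rw [inv_mul_cancel, h.one] at this
  exact eq_inv_of_mul_eq_one_left this.symm

theorem PSCrossed.comm {F V : Type*} [Group F] [CommGroup V] {ρ : F →* MulAut V} {D : F → V}
    (h : PSCrossed ρ D) (a b : F) :
    D ⁅a, b⁆ = (D a / ρ (a * b * a⁻¹) (D a)) * (ρ a (D b) / ρ ⁅a, b⁆ (D b)) := by
  rw [commutatorElement_def, h (a * b * a⁻¹) b⁻¹, h (a * b) a⁻¹, h a b, h.inv, h.inv]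
  simp only [map_inv, ← MulAut.mul_apply]
  simp only [map_mul, map_inv, div_eq_mul_inv]
  generalize (ρ a * ρ b * (ρ a)⁻¹) (D a) = x
  generalize (ρ a * ρ b * (ρ a)⁻¹ * (ρ b)⁻¹) (D b) = y
  generalize ρ a (D b) = w
  generalize D a = q
  simp only [mul_comm, mul_left_comm, mul_assoc]

theorem PSCrossed.list_one {F V : Type*} [Group F] [CommGroup V] {ρ : F →* MulAut V} {D : F → V}
    (h : PSCrossed ρ D) (l : List F) (hl : ∀ x ∈ l, D x = 1) : D l.prod = 1 := by
  induction l with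
  | nil => simpa using h.one
  | cons a l ih =>
    rw [List.prod_cons, h, hl a (by simp), ih (fun x hx => hl x (by simp [hx]))]
    simp

theorem PSCrossed.exists_free {α V : Type*} [CommGroup V] (ρ : FreeGroup α →* MulAut V)
    (η : α → V) : ∃ D : FreeGroup α → V, PSCrossed ρ D ∧ ∀ x, D (FreeGroup.of x) = η x := by
  let Φ : FreeGroup α →* V ⋊[ρ] FreeGroup α :=
    FreeGroup.lift (fun x => ⟨η x, FreeGroup.of x⟩)
  have hr : ∀ w, (Φ w).right = w := by
    intro w
    have : (SemidirectProduct.rightHom.comp Φ) = MonoidHom.id _ := by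
      ext x
      simp [Φ]
    exact DFunLike.congr_fun this w
  refine ⟨fun w => (Φ w).left, ?_, ?_⟩
  · intro u w
    simp [hr]
  · intro x
    simp [Φ]

/-- `H²` of a surface group is computed by coinvariants. -/
theorem PSCrossed.exists_relator (g : ℕ) {V : Type*} [CommGroup V]
    (ρ : FreeGroup (Fin g × Bool) →* MulAut V) (z : V)
    (hz : z ∈ Subgroup.closure {y : V | ∃ x v, y = ρ x v / v}) :
    ∃ D, PSCrossed ρ D ∧ D (surfaceRelator g) = z := by
  let W : Subgroup V :=
    { carrier := {y | ∃ D, PSCrossed ρ D ∧ D (surfaceRelator g) = y}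
      one_mem' := ⟨fun _ => 1, fun u w => by simp, rfl⟩
      mul_mem' := by
        rintro _ _ ⟨D, hD, rfl⟩ ⟨D', hD', rfl⟩
        refine ⟨fun w => D w * D' w, fun u w => ?_, rfl⟩
        simp only [hD u w, hD' u w, map_mul]
        exact mul_mul_mul_comm _ _ _ _
      inv_mem' := by
        rintro _ ⟨D, hD, rfl⟩
        refine ⟨fun w => (D w)⁻¹, fun u w => ?_, rfl⟩
        simp only [hD u w, map_inv, mul_inv] }
  let S : Subgroup (FreeGroup (Fin g × Bool)) :=
    { carrier := {x | ∀ v, ρ x v / v ∈ W}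
      one_mem' := fun v => by simp [W.one_mem]
      mul_mem' := by
        intro a b ha hb v
        have := W.mul_mem (ha (ρ b v)) (hb v)
        simpa [div_mul_div_cancel] using this
      inv_mem' := by
        intro a ha v
        have := W.inv_mem (ha (ρ a⁻¹ v))
        simpa using this }
  have hSdef : ∀ x, x ∈ S ↔ ∀ v, ρ x v / v ∈ W := fun x => Iff.rfl
  have key : ∀ i : Fin g, FreeGroup.of (i, true) ∈ S ∧ FreeGroup.of (i, false) ∈ S := by
    suffices H : ∀ (k : ℕ) (i : Fin g), (i : ℕ) = k →
        FreeGroup.of (i, true) ∈ S ∧ FreeGroup.of (i, false) ∈ S from fun i => H i i rfl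
    intro k
    induction k using Nat.strong_induction_on with
    | _ k ih =>
    intro i hik
    set a : FreeGroup (Fin g × Bool) := FreeGroup.of (i, true) with ha
    set b : FreeGroup (Fin g × Bool) := FreeGroup.of (i, false) with hb
    let f : Fin g → FreeGroup (Fin g × Bool) := fun i : Fin g =>
      ⁅FreeGroup.of (i, true), FreeGroup.of (i, false)⁆
    let l := List.ofFn f
    have hlen : (i : ℕ) < l.length := by simp [l]
    have hsplit : surfaceRelator g = (l.take i).prod * (f i * (l.drop (i + 1)).prod) := by
      have h1 : l = l.take i ++ l[(i : ℕ)] :: l.drop (i + 1) := by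
        rw [← List.drop_eq_getElem_cons hlen, List.take_append_drop]
      have h2 : l[(i : ℕ)] = f i := by simp [l]
      rw [h2] at h1
      rw [← List.prod_cons, ← List.prod_append, ← h1]
      rfl
    have hP : (l.take i).prod ∈ S := by
      apply Subgroup.list_prod_mem
      intro x hx
      rw [List.mem_take_iff_getElem] at hx
      obtain ⟨j, hj, rfl⟩ := hx
      have hj' : j < g := by simp [l] at hj; omega
      have hji : j < k := by simp [l] at hj; omega
      have := ih j hji ⟨j, hj'⟩ rfl
      simp only [l, List.getElem_ofFn, f, commutatorElement_def]
      exact S.mul_mem (S.mul_mem (S.mul_mem this.1 this.2) (S.inv_mem this.1)) (S.inv_mem this.2)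
    have main : ∀ α β : V,
        (α / ρ (a * b * a⁻¹) α) * (ρ a β / ρ ⁅a, b⁆ β) ∈ W := by
      intro α β
      obtain ⟨D, hD, hDη⟩ := PSCrossed.exists_free ρ
        (fun x => if x = (i, true) then α else if x = (i, false) then β else 1)
      have hDa : D a = α := by simp [ha, hDη]
      have hDb : D b = β := by simp [hb, hDη]
      have hDj : ∀ j, j ≠ i → D (f j) = 1 := by
        intro j hj
        simp only [f]
        rw [hD.comm, hDη, hDη]
        simp [hj]
      have h1 : D (l.take i).prod = 1 := by
        apply hD.list_one
        intro x hx
        rw [List.mem_take_iff_getElem] at hx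
        obtain ⟨j, hj, rfl⟩ := hx
        simp only [l, List.getElem_ofFn]
        apply hDj
        intro h
        have := congrArg Fin.val h
        simp at this
        omega
      have h2 : D (l.drop (i + 1)).prod = 1 := by
        apply hD.list_one
        intro x hx
        rw [List.mem_drop_iff_getElem] at hx
        obtain ⟨j, hj, rfl⟩ := hx
        simp only [l, List.getElem_ofFn]
        apply hDj
        intro h
        have := congrArg Fin.val h
        simp at this
        omega
      have h3 : ρ (l.take i).prod (D (f i)) ∈ W := by
        refine ⟨D, hD, ?_⟩
        rw [hsplit, hD, hD, h1, h2]
        simp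
      have h4 := W.div_mem h3 (hP (D (f i)))
      rw [div_div_cancel] at h4
      simp only [f] at h4
      rw [← ha, ← hb, hD.comm, hDa, hDb] at h4
      exact h4
    -- relations modulo `W`
    let χ := QuotientGroup.mk' W
    have hχ : ∀ x y : V, x / y ∈ W → χ x = χ y := by
      intro x y h
      rw [← div_eq_one, ← map_div]
      exact (QuotientGroup.eq_one_iff _).2 h
    have e1 : ∀ v, χ v = χ (ρ (a * b * a⁻¹) v) := fun v => hχ _ _ (by simpa using main v 1)
    have e2 : ∀ v, χ (ρ a v) = χ (ρ ⁅a, b⁆ v) := fun v => hχ _ _ (by simpa using main 1 v)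
    have e3 : ∀ v, χ (ρ a v) = χ (ρ (a * b) v) := fun v => by
      rw [e1 (ρ a v), ← MulAut.mul_apply, ← map_mul, inv_mul_cancel_right]
    have e4 : ∀ v, χ (ρ a v) = χ v := fun v => by
      rw [e3, map_mul, MulAut.mul_apply, e2, ← MulAut.mul_apply, ← map_mul,
        commutatorElement_def, inv_mul_cancel_right, ← e1]
    have e5 : ∀ v, χ (ρ b v) = χ v := fun v => by
      rw [← e4 (ρ b v), ← MulAut.mul_apply, ← map_mul, ← e3, e4]
    have hχ' : ∀ x y : V, χ x = χ y → x / y ∈ W := by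
      intro x y h
      rw [← div_eq_one, ← map_div] at h
      exact (QuotientGroup.eq_one_iff _).1 h
    exact ⟨fun v => hχ' _ _ (e4 v), fun v => hχ' _ _ (e5 v)⟩
  have htop : S = ⊤ := by
    rw [eq_top_iff, ← FreeGroup.closure_range_of, Subgroup.closure_le]
    rintro _ ⟨⟨i, b⟩, rfl⟩
    cases b
    · exact (key i).2
    · exact (key i).1
  have : Subgroup.closure {y : V | ∃ x v, y = ρ x v / v} ≤ W := by
    rw [Subgroup.closure_le]
    rintro _ ⟨x, v, rfl⟩
    exact (hSdef x).1 (htop ▸ Subgroup.mem_top x) v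
  exact this hz

/-- Functions from `B` to `M`, as a commutative group. -/
def PSFun (B M : Type*) := B → M

instance psFunCommGroup (B M : Type*) [CommGroup M] : CommGroup (PSFun B M) :=
  inferInstanceAs (CommGroup (B → M))

/-- Evaluation at `t`. -/
def psEval {B M : Type*} [CommGroup M] (t : B) : PSFun B M →* M where
  toFun v := v t
  map_one' := rfl
  map_mul' _ _ := rfl

theorem psFun_ext {B M : Type*} [CommGroup M] {v w : PSFun B M}
    (h : ∀ t, psEval t v = psEval t w) : v = w := funext h

/-- Build an element of `PSFun`. -/
def psMk {B M : Type*} (v : B → M) : PSFun B M := v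

theorem psEval_mk {B M : Type*} [CommGroup M] (v : B → M) (t : B) : psEval t (psMk v) = v t := rfl

/-- The shift action of `F` on functions on a group `B` receiving a map from `F`. -/
def psShift {F B M : Type*} [Group F] [Group B] [CommGroup M] (q : F →* B) :
    F →* MulAut (PSFun B M) where
  toFun x :=
    { toFun := fun v => psMk fun t => psEval (t * q x) v
      invFun := fun v => psMk fun t => psEval (t * (q x)⁻¹) v
      left_inv := fun v => psFun_ext fun t => by simp [psEval_mk]
      right_inv := fun v => psFun_ext fun t => by simp [psEval_mk]
      map_mul' := fun v w => psFun_ext fun t => by simp [psEval_mk] }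
  map_one' := by
    apply MulEquiv.ext
    intro v
    apply psFun_ext
    intro t
    simp [psEval_mk]
  map_mul' x y := by
    apply MulEquiv.ext
    intro v
    apply psFun_ext
    intro t
    simp [psEval_mk, mul_assoc]

theorem psShift_apply {F B M : Type*} [Group F] [Group B] [CommGroup M] (q : F →* B)
    (x : F) (v : PSFun B M) (t : B) : psEval t (psShift q x v) = psEval (t * q x) v := rfl

open Classical in
/-- Function supported at one point. -/
noncomputable def psSingle {B M : Type*} [CommGroup M] (t : B) (u : M) : PSFun B M :=
  psMk fun s => if s = t then u else 1

open Classical in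
theorem psEval_single {B M : Type*} [CommGroup M] (s t : B) (u : M) :
    psEval s (psSingle t u) = if s = t then u else 1 := rfl

theorem ps_mem_closure {F B M : Type*} [Group F] [Group B] [Fintype B] [CommGroup M]
    (q : F →* B) (hq : Function.Surjective q) (z : B → M) (hz : ∏ t, z t = 1) :
    psMk z ∈ Subgroup.closure {y : PSFun B M | ∃ x v, y = psShift q x v / v} := by
  classical
  have h1 : psMk z = ∏ t, (psSingle t (z t) / psSingle 1 (z t)) := by
    apply psFun_ext
    intro s
    rw [map_prod, psEval_mk]
    simp only [map_div, psEval_single]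
    rw [Finset.prod_div_distrib, Finset.prod_ite_eq]
    by_cases h : s = 1 <;> simp [h, hz]
  rw [h1]
  apply Subgroup.prod_mem
  intro t _
  apply Subgroup.subset_closure
  obtain ⟨x, hx⟩ := hq t⁻¹
  refine ⟨x, psSingle 1 (z t), ?_⟩
  congr 1
  apply psFun_ext
  intro s
  rw [psShift_apply, hx, psEval_single, psEval_single]
  simp only [mul_inv_eq_one]

theorem ps_prod_comp {B' B M : Type*} [Group B'] [Group B] [Fintype B'] [Fintype B] [CommGroup M]
    (q : B' →* B) (hq : Function.Surjective q) (z : B → M) (m : ℕ)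
    (hm : m ∣ Nat.card q.ker) (hz : ∀ b, z b ^ m = 1) : ∏ t, z (q t) = 1 := by
  classical
  rw [← Finset.prod_fiberwise (g := q)]
  apply Finset.prod_eq_one
  intro b _
  have h1 : ∏ i with q i = b, z (q i) = ∏ i with q i = b, z b :=
    Finset.prod_congr rfl (fun i hi => by rw [(Finset.mem_filter.1 hi).2])
  rw [h1, Finset.prod_const]
  obtain ⟨t, rfl⟩ := hq b
  have h2 : (Finset.univ.filter (fun i => q i = q t)).card = Nat.card q.ker := by
    rw [← Fintype.card_subtype, ← Nat.card_eq_fintype_card]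
    refine Nat.card_congr ⟨fun x => ⟨x.1 * t⁻¹, ?_⟩, fun x => ⟨x.1 * t, ?_⟩, ?_, ?_⟩
    · rw [MonoidHom.mem_ker, map_mul, x.2]; simp
    · have := x.2
      rw [MonoidHom.mem_ker] at this
      rw [map_mul, this, one_mul]
    · intro x; simp
    · intro x; simp
  rw [h2]
  obtain ⟨k, hk⟩ := hm
  rw [hk, pow_mul, hz, one_pow]

theorem ps_index_of_map {E S : Type*} [Group E] [Group S] (p : E →* S) (hfin : Finite p.ker)
    (Δ : Subgroup E) (h : (Δ.map p).index ≠ 0) : Δ.index ≠ 0 := by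
  rw [Subgroup.index_map] at h
  have h1 : (Δ ⊔ p.ker).index ≠ 0 := left_ne_zero_of_mul h
  rw [← Subgroup.relIndex_mul_index (le_sup_left : Δ ≤ Δ ⊔ p.ker)]
  refine mul_ne_zero ?_ h1
  have : Finite ((Δ ⊔ p.ker : Subgroup E) ⧸ Δ.subgroupOf (Δ ⊔ p.ker)) := by
    let F : p.ker → (Δ ⊔ p.ker : Subgroup E) ⧸ Δ.subgroupOf (Δ ⊔ p.ker) :=
      fun n => QuotientGroup.mk ⟨n.1, le_sup_right (a := Δ) n.2⟩
    apply Finite.of_surjective F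
    intro y
    induction y using QuotientGroup.induction_on with
    | H y =>
      obtain ⟨y, hy⟩ := y
      have hy' := hy
      rw [sup_comm, Subgroup.mem_sup_of_normal_left] at hy'
      obtain ⟨n, hn, d, hd, rfl⟩ := hy'
      refine ⟨⟨n, hn⟩, ?_⟩
      refine QuotientGroup.eq.2 ?_
      rw [Subgroup.mem_subgroupOf]
      simpa using hd
  exact Subgroup.index_ne_zero_of_finite

abbrev PSFree (g : ℕ) := FreeGroup (Fin g × Bool)

theorem ps_deep (g : ℕ) (hg : 2 ≤ g) (K1 : Subgroup (PSFree g)) [K1.Normal] [K1.FiniteIndex]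
    (hRK1 : Subgroup.normalClosure {surfaceRelator g} ≤ K1) (m : ℕ) (hm : 0 < m) :
    ∃ K : Subgroup (PSFree g), ∃ _ : K.Normal, ∃ hKK1 : K ≤ K1, K.FiniteIndex ∧
      Subgroup.normalClosure {surfaceRelator g} ≤ K ∧
      m ∣ Nat.card (QuotientGroup.map K K1 (MonoidHom.id (PSFree g)) hKK1).ker := by
  classical
  let B := (PSFree g) ⧸ K1
  have : Finite B := Subgroup.finite_quotient_of_finiteIndex
  let r : PSFree g := surfaceRelator g
  -- the deeper subgroup
  let N := m * Nat.card B
  have hNB : 0 < Nat.card B := Nat.card_pos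
  have : NeZero N := ⟨(Nat.mul_pos hm hNB).ne'⟩
  let i0 : Fin g := ⟨0, by omega⟩
  let χ : PSFree g →* Multiplicative (ZMod N) :=
    FreeGroup.lift (fun x => if x = (i0, true) then Multiplicative.ofAdd 1 else 1)
  have hχr : χ r = 1 := by
    have : χ r = ((List.ofFn fun i : Fin g =>
      ⁅FreeGroup.of (i, true), FreeGroup.of (i, false)⁆).map χ).prod := map_list_prod χ _
    rw [this]
    apply List.prod_eq_one
    intro x hx
    simp only [List.mem_map, List.mem_ofFn] at hx
    obtain ⟨_, ⟨i, rfl⟩, rfl⟩ := hx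
    rw [map_commutatorElement, commutatorElement_eq_one_iff_mul_comm, mul_comm]
  let K := K1 ⊓ χ.ker
  have hKn : K.Normal := inferInstance
  have hKfi : K.FiniteIndex := inferInstance
  have hRχ : Subgroup.normalClosure {surfaceRelator g} ≤ χ.ker := by
    apply Subgroup.normalClosure_le_normal
    rintro _ rfl
    exact hχr
  have hRK : Subgroup.normalClosure {surfaceRelator g} ≤ K := le_inf hRK1 hRχ
  have hKK1 : K ≤ K1 := inf_le_left
  let B' := (PSFree g) ⧸ K
  have : Finite B' := Subgroup.finite_quotient_of_finiteIndex
  have : Fintype B' := Fintype.ofFinite B'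
  let q : B' →* B := QuotientGroup.map K K1 (MonoidHom.id (PSFree g)) hKK1
  refine ⟨K, hKn, hKK1, hKfi, hRK, ?_⟩
  change m ∣ Nat.card q.ker
  let a : PSFree g := FreeGroup.of (i0, true)
  have hκ : ((a ^ Nat.card B : PSFree g) : B') ∈ q.ker := by
    rw [MonoidHom.mem_ker]
    change ((a ^ Nat.card B : PSFree g) : B) = 1
    rw [QuotientGroup.mk_pow]
    exact pow_card_eq_one'
  let κ : q.ker := ⟨((a ^ Nat.card B : PSFree g) : B'), hκ⟩
  refine dvd_trans ?_ (orderOf_dvd_natCard κ)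
  have h1 : κ ^ orderOf κ = 1 := pow_orderOf_eq_one κ
  have h2 := congrArg Subtype.val h1
  have h3 : ((a ^ Nat.card B) ^ orderOf κ : PSFree g) ∈ K := by
    rw [← QuotientGroup.eq_one_iff]
    exact h2
  have h4 : χ ((a ^ Nat.card B) ^ orderOf κ) = 1 := h3.2
  have h5 : χ a = Multiplicative.ofAdd 1 := (FreeGroup.lift_apply_of).trans (if_pos rfl)
  rw [← pow_mul, map_pow, h5, ← ofAdd_nsmul, ofAdd_eq_one, nsmul_one,
    ZMod.natCast_eq_zero_iff, mul_comm] at h4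
  exact Nat.dvd_of_mul_dvd_mul_right hNB h4

theorem ps_psi_aux (g : ℕ) {M B B' : Type*} [CommGroup M] [Group B] [Group B'] [Finite B]
    [Finite B'] (q' : PSFree g →* B') (hq' : Function.Surjective q') (q : B' →* B)
    (hq : Function.Surjective q) (m : ℕ) (hr : q' (surfaceRelator g) = 1)
    (hmq : m ∣ Nat.card q.ker) (z : B → M) (hzm : ∀ b, z b ^ m = 1) :
    ∃ D : PSFree g → M, (∀ u w, q' u = 1 → D (u * w) = D u * D w) ∧
      ∀ t : PSFree g, D (t * surfaceRelator g * t⁻¹) = z (q (q' t)) := by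
  have : Fintype B := Fintype.ofFinite B
  have : Fintype B' := Fintype.ofFinite B'
  have h1 : ∏ t, z (q t) = 1 := ps_prod_comp q hq z m hmq hzm
  have h2 := ps_mem_closure q' hq' (fun t => z (q t)) h1
  obtain ⟨D, hD, hDr⟩ := PSCrossed.exists_relator g (psShift q') (psMk fun t => z (q t)) h2
  refine ⟨fun w => psEval 1 (D w), ?_, ?_⟩
  · intro u w hu
    simp only [hD u w, map_mul, psShift_apply, hu, mul_one]
  · intro t
    have h1 : psEval 1 (D (t * t⁻¹)) = 1 := by rw [mul_inv_cancel, hD.one, map_one]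
    rw [hD, map_mul, psShift_apply, one_mul] at h1
    have h3 : psEval (1 * q' t) (D (surfaceRelator g)) = z (q (q' t)) := by
      rw [hDr, psEval_mk, one_mul]
    have h4 : q' (t * surfaceRelator g) = q' t := by rw [map_mul, hr, mul_one]
    change psEval 1 (D (t * surfaceRelator g * t⁻¹)) = _
    rw [hD, hD, map_mul, map_mul, psShift_apply, psShift_apply, h3, h4, one_mul,
      mul_right_comm, h1, one_mul]

theorem ps_psi (g : ℕ) {M : Type*} [CommGroup M] (K1 K : Subgroup (PSFree g)) [K1.Normal]
    [K.Normal] [K1.FiniteIndex] [hKfi : K.FiniteIndex] (hKK1 : K ≤ K1) (m : ℕ)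
    (hRK : ∀ t, t * surfaceRelator g * t⁻¹ ∈ K)
    (hmq : m ∣ Nat.card (QuotientGroup.map K K1 (MonoidHom.id (PSFree g)) hKK1).ker)
    (z : (PSFree g) ⧸ K1 → M) (hzm : ∀ b, z b ^ m = 1) :
    ∃ ψ : K →* M, ∀ t : PSFree g, ψ ⟨t * surfaceRelator g * t⁻¹, hRK t⟩ = z t := by
  have hrK : surfaceRelator g ∈ K := by simpa using hRK 1
  obtain ⟨D, hD, hDr⟩ := ps_psi_aux g (QuotientGroup.mk' K) (QuotientGroup.mk'_surjective K)
    (QuotientGroup.map K K1 (MonoidHom.id (PSFree g)) hKK1)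
    (fun b => by
      induction b using QuotientGroup.induction_on with
      | H t => exact ⟨(t : PSFree g ⧸ K), rfl⟩) m
    ((QuotientGroup.eq_one_iff _).2 hrK) hmq z hzm
  refine ⟨MonoidHom.mk' (fun w => D w)
    (fun u w => hD u w ((QuotientGroup.eq_one_iff _).2 u.2)), fun t => hDr t⟩

/-- Finite central extensions of finite-index subgroups of surface groups virtually split. -/
theorem ps_central_aux (g : ℕ) (hg : 2 ≤ g) {E M : Type*} [Group E] [CommGroup M] [Finite M]
    (p : E →* SurfaceGroup g) (ι : M →* E) (hι : ι.range = p.ker)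
    (hfin : Finite p.ker) (hc : p.ker ≤ Subgroup.center E) (hr : p.range.index ≠ 0) :
    ∃ Δ : Subgroup E, Δ.index ≠ 0 ∧ Δ ⊓ p.ker = ⊥ := by
  classical
  have hpι : ∀ u, p (ι u) = 1 := fun u => by
    rw [← MonoidHom.mem_ker, ← hι]; exact ⟨u, rfl⟩
  have hcι : ∀ u x, x * ι u = ι u * x := fun u x =>
    Subgroup.mem_center_iff.1 (hc (hpι u)) x
  let π : PSFree g →* SurfaceGroup g := PresentedGroup.mk _
  have hπ : Function.Surjective π := PresentedGroup.mk_surjective _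
  have hπker : π.ker = Subgroup.normalClosure {surfaceRelator g} := QuotientGroup.ker_mk' _
  let r : PSFree g := surfaceRelator g
  have hrR : r ∈ π.ker := by
    rw [hπker]; exact Subgroup.subset_normalClosure rfl
  let K0 : Subgroup (PSFree g) := p.range.comap π
  have hK0 : K0.index ≠ 0 := by
    rw [Subgroup.index_comap_of_surjective _ hπ]; exact hr
  have hRK0 : π.ker ≤ K0 := fun x hx => by
    rw [MonoidHom.mem_ker] at hx
    rw [Subgroup.mem_comap, hx]; exact Subgroup.one_mem _
  -- lifting
  obtain ⟨L, hL⟩ : ∃ L : K0 →* E, ∀ w : K0, p (L w) = π w := by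
    have hex : ∀ w : K0, ∃ e : E, p e = π w := fun w => w.2
    choose e he using hex
    refine ⟨IsFreeGroup.lift (fun x => e (IsFreeGroup.of x)), ?_⟩
    intro w
    have : p.comp (IsFreeGroup.lift (fun x => e (IsFreeGroup.of x))) = π.comp K0.subtype := by
      apply IsFreeGroup.ext_hom
      intro x
      simp only [MonoidHom.comp_apply, IsFreeGroup.lift_of, he]
      rfl
    exact DFunLike.congr_fun this w
  let K1 := K0.normalCore
  have hK1fi : K1.FiniteIndex := by
    have : K0.FiniteIndex := ⟨hK0⟩
    exact Subgroup.finiteIndex_normalCore K0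
  have hK1K0 : K1 ≤ K0 := Subgroup.normalCore_le K0
  have hRK1 : π.ker ≤ K1 := Subgroup.normal_le_normalCore.2 hRK0
  let B := (PSFree g) ⧸ K1
  have : Finite B := Subgroup.finite_quotient_of_finiteIndex
  let m := Nat.card M
  have hm : 0 < m := Nat.card_pos
  have hconjR : ∀ t : PSFree g, t * r * t⁻¹ ∈ π.ker := fun t =>
    (MonoidHom.normal_ker π).conj_mem r hrR t
  let θ : PSFree g → E := fun t => L ⟨t * r * t⁻¹, hRK0 (hconjR t)⟩
  have hθker : ∀ t, θ t ∈ p.ker := fun t => by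
    rw [MonoidHom.mem_ker, hL]
    exact hconjR t
  have hθinv : ∀ k ∈ K0, ∀ t, θ (k * t) = θ t := by
    intro k hk t
    have h1 : θ (k * t) = L ⟨k, hk⟩ * θ t * (L ⟨k, hk⟩)⁻¹ := by
      simp only [θ, ← map_inv, ← map_mul]
      congr 1
      ext
      simp [mul_assoc]
    rw [h1, Subgroup.mem_center_iff.1 (hc (hθker t)) (L ⟨k, hk⟩), mul_inv_cancel_right]
  have hzex : ∀ b : B, ∃ u : M, ι u = θ b.out := fun b => by
    have := hθker b.out
    rwa [← hι] at this
  choose z hzθ using hzex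
  have hz : ∀ t : PSFree g, θ t = ι (z (t : B)) := by
    intro t
    have h1 : ((t : B).out)⁻¹ * t ∈ K1 := QuotientGroup.eq.1 (QuotientGroup.out_eq' (t : B))
    have h2 : t * ((t : B).out)⁻¹ ∈ K1 := by
      exact (Subgroup.normalCore_normal K0).mem_comm h1
    have := hθinv _ (hK1K0 h2) ((t : B).out)
    rw [inv_mul_cancel_right] at this
    rw [this, hzθ]
  have hzm : ∀ b, z b ^ m = 1 := by
    intro b
    exact pow_card_eq_one'
  have hK1n : K1.Normal := Subgroup.normalCore_normal K0
  obtain ⟨K, hKn, hKK1, hKfi, hRK', hmq⟩ := ps_deep g hg K1 (hπker ▸ hRK1) m hm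
  have hRK : π.ker ≤ K := hπker ▸ hRK'
  obtain ⟨ψ, hψ⟩ := ps_psi g K1 K hKK1 m (fun t => hRK (hconjR t)) hmq z hzm
  let L' : K →* E :=
    { toFun := fun w => L ⟨w, hK1K0 (hKK1 w.2)⟩ * ι (ψ w)⁻¹
      map_one' := by
        rw [map_one ψ]
        simp only [inv_one, map_one ι, mul_one]
        exact map_one L
      map_mul' := fun u w => by
        have h1 : L ⟨(u * w : K), hK1K0 (hKK1 (u * w).2)⟩ =
          L ⟨u, hK1K0 (hKK1 u.2)⟩ * L ⟨w, hK1K0 (hKK1 w.2)⟩ := by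
          rw [← map_mul]; rfl
        rw [h1, map_mul ψ, mul_inv, map_mul ι]
        have h2 := hcι (ψ u)⁻¹ (L ⟨w, hK1K0 (hKK1 w.2)⟩)
        simp only [mul_assoc]
        congr 1
        rw [← mul_assoc, h2, mul_assoc] }
  have hL'R : ∀ w (hw : w ∈ π.ker), L' ⟨w, hRK hw⟩ = 1 := by
    have : π.ker ≤ L'.ker.map K.subtype := by
      rw [hπker, Subgroup.normalClosure, Subgroup.closure_le]
      intro x hx
      rw [Group.mem_conjugatesOfSet_iff] at hx
      obtain ⟨_, rfl, hx⟩ := hx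
      rw [isConj_iff] at hx
      obtain ⟨t, rfl⟩ := hx
      refine ⟨⟨t * r * t⁻¹, hRK (hconjR t)⟩, ?_, rfl⟩
      change L' _ = 1
      have h1 : L ⟨t * r * t⁻¹, hRK0 (hconjR t)⟩ = ι (z (t : B)) := hz t
      have h2 : ψ ⟨t * r * t⁻¹, hRK (hconjR t)⟩ = z (t : B) := hψ t
      change L ⟨t * r * t⁻¹, _⟩ * ι (ψ ⟨t * r * t⁻¹, _⟩)⁻¹ = 1
      rw [h1, h2]
      simp
    intro w hw
    obtain ⟨⟨w', hw'⟩, h1, rfl⟩ := this hw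
    exact h1
  have hpL' : ∀ w : K, p (L' w) = π w := by
    intro w
    change p (L ⟨w, hK1K0 (hKK1 w.2)⟩ * ι (ψ w)⁻¹) = π w
    rw [map_mul, hL, hpι, mul_one]
  refine ⟨L'.range, ?_, ?_⟩
  · apply ps_index_of_map p hfin
    have : L'.range.map p = K.map π := by
      ext x
      simp only [Subgroup.mem_map, MonoidHom.mem_range]
      constructor
      · rintro ⟨_, ⟨w, rfl⟩, rfl⟩
        exact ⟨w, w.2, (hpL' w).symm⟩
      · rintro ⟨w, hw, rfl⟩
        exact ⟨_, ⟨⟨w, hw⟩, rfl⟩, hpL' _⟩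
    rw [this]
    exact ne_zero_of_dvd_ne_zero hKfi.index_ne_zero (Subgroup.index_map_dvd _ hπ)
  · rw [eq_bot_iff]
    rintro _ ⟨⟨w, rfl⟩, hw⟩
    have h1 : p (L' w) = 1 := hw
    rw [hpL'] at h1
    exact hL'R w.1 h1

theorem ps_central (g : ℕ) (hg : 2 ≤ g) {E : Type*} [Group E] (p : E →* SurfaceGroup g)
    (hfin : Finite p.ker) (hc : p.ker ≤ Subgroup.center E) (hr : p.range.index ≠ 0) :
    ∃ Δ : Subgroup E, Δ.index ≠ 0 ∧ Δ ⊓ p.ker = ⊥ := by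
  let _ : CommGroup p.ker :=
    { (inferInstance : Group p.ker) with
      mul_comm := fun a b => Subtype.ext (Subgroup.mem_center_iff.1 (hc b.2) a.1) }
  exact ps_central_aux g hg p p.ker.subtype (Subgroup.range_subtype _) hfin hc hr

/-- Finite extensions of surface groups: the kernel is missed by a finite-index subgroup. -/
theorem ps_surface (g : ℕ) (hg : 2 ≤ g) {E : Type*} [Group E] (f : E →* SurfaceGroup g)
    (hf : Function.Surjective f) (hfin : Finite f.ker) :
    ∃ Δ : Subgroup E, Δ.index ≠ 0 ∧ Δ ⊓ f.ker = ⊥ := by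
  let c : E →* MulAut f.ker := MulAut.conjNormal
  have : Finite (MulAut f.ker) :=
    Finite.of_injective (fun e : MulAut f.ker => (e : f.ker → f.ker)) DFunLike.coe_injective
  let C := c.ker
  have hC : C.index ≠ 0 := Subgroup.FiniteIndex.index_ne_zero
  have hCc : ∀ x ∈ C, ∀ y ∈ f.ker, x * y = y * x := by
    intro x hx y hy
    have h1 : c x = 1 := hx
    have h2 := congrArg Subtype.val (DFunLike.congr_fun h1 (⟨y, hy⟩ : f.ker))
    have h3 : x * y * x⁻¹ = y := by
      rw [MulAut.conjNormal_apply] at h2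
      exact h2
    exact mul_inv_eq_iff_eq_mul.1 h3
  let p : C →* SurfaceGroup g := f.comp C.subtype
  have hpk : ∀ x : C, x ∈ p.ker ↔ (x : E) ∈ f.ker := fun x => Iff.rfl
  have hfin' : Finite p.ker :=
    Finite.of_injective (fun x : p.ker => (⟨x.1.1, (hpk _).1 x.2⟩ : f.ker)) (by
      intro x y h
      have := congrArg Subtype.val h
      exact Subtype.ext (Subtype.ext this))
  obtain ⟨Δ, h1, h2⟩ := ps_central g hg p hfin'
    (fun y hy => Subgroup.mem_center_iff.2 fun x => Subtype.ext (hCc x.1 x.2 y.1 hy))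
    (by
      have : p.range = C.map f := by
        ext x
        simp [p, MonoidHom.mem_range, Subgroup.mem_map]
      rw [this]
      exact ne_zero_of_dvd_ne_zero hC (Subgroup.index_map_dvd _ hf))
  refine ⟨Δ.map C.subtype, ?_, ?_⟩
  · rw [Subgroup.index_map_subtype]
    exact mul_ne_zero h1 hC
  · rw [eq_bot_iff]
    rintro _ ⟨⟨x, hx, rfl⟩, hk⟩
    have : x ∈ Δ ⊓ p.ker := ⟨hx, hk⟩
    rw [h2, Subgroup.mem_bot] at this
    rw [this]
    exact Subgroup.one_mem _

theorem ps_finite_hom (N P : Type*) [Group N] [Group P] [Finite P] (hN : Group.FG N) :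
    Finite (N →* P) := by
  obtain ⟨S, hS, hSf⟩ := Group.fg_iff.1 hN
  have : Finite S := hSf
  apply Finite.of_injective (fun (φ : N →* P) (s : S) => φ s)
  intro φ ψ h
  apply MonoidHom.eq_of_eqOn_dense hS
  intro s hs
  exact congrFun h ⟨s, hs⟩

/-- A finite-index subgroup of a finitely generated group contains a
characteristic finite-index subgroup. -/
theorem ps_char_core {N : Type*} [Group N] (hN : Group.FG N) (D : Subgroup N)
    (hD : D.index ≠ 0) : ∃ D0 : Subgroup N, D0 ≤ D ∧ D0.index ≠ 0 ∧
      ∀ e : N ≃* N, ∀ x ∈ D0, e x ∈ D0 := by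
  have : D.FiniteIndex := ⟨hD⟩
  have : Finite (N ⧸ D) := Subgroup.finite_quotient_of_finiteIndex
  have : Finite (N →* Equiv.Perm (N ⧸ D)) := ps_finite_hom _ _ hN
  refine ⟨⨅ φ : N →* Equiv.Perm (N ⧸ D), φ.ker, ?_, ?_, ?_⟩
  · refine (iInf_le _ (MulAction.toPermHom N (N ⧸ D))).trans ?_
    rw [← Subgroup.normalCore_eq_ker]
    exact Subgroup.normalCore_le D
  · apply Subgroup.index_iInf_ne_zero
    intro φ
    exact Subgroup.FiniteIndex.index_ne_zero
  · intro e x hx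
    rw [Subgroup.mem_iInf] at hx ⊢
    intro φ
    exact hx (φ.comp e.toMonoidHom)

theorem ps_fg_ext {T S : Type*} [Group T] [Group S] (f : T →* S) (hf : Function.Surjective f)
    (hS : Group.FG S) (hN : f.ker.FG) : Group.FG T := by
  obtain ⟨A, hA⟩ := hN
  obtain ⟨X, hX, hXf⟩ := Group.fg_iff.1 hS
  choose l hl using hf
  refine Group.fg_iff.2 ⟨(A : Set T) ∪ l '' X, ?_, A.finite_toSet.union (hXf.image l)⟩
  rw [Subgroup.closure_union, hA, eq_top_iff]
  intro t _
  have h1 : (f.ker ⊔ Subgroup.closure (l '' X)).map f = ⊤ := by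
    rw [eq_top_iff, ← hX, Subgroup.closure_le]
    intro x hx
    exact ⟨l x, Subgroup.mem_sup_right (Subgroup.subset_closure ⟨x, hx, rfl⟩), hl x⟩
  have h2 : f t ∈ (f.ker ⊔ Subgroup.closure (l '' X)).map f := h1 ▸ Subgroup.mem_top _
  obtain ⟨u, hu, hut⟩ := h2
  have h3 : t * u⁻¹ ∈ f.ker := by
    rw [MonoidHom.mem_ker, map_mul, map_inv, hut, mul_inv_cancel]
  have := Subgroup.mul_mem _ (Subgroup.mem_sup_left (T := Subgroup.closure (l '' X)) h3) hu
  simpa using this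

/-- The inductive step. -/
theorem ps_step (g : ℕ) (hg : 2 ≤ g) {T : Type*} [Group T] (f : T →* SurfaceGroup g)
    (hf : Function.Surjective f) (hN : Group.FG f.ker) (A : Subgroup T) (hA : A ≤ f.ker)
    (D : Subgroup f.ker) (hD : D.index ≠ 0) (hDA : ∀ x ∈ D, (x : T) ∈ A → x = 1) :
    ∃ Δ : Subgroup T, Δ.index ≠ 0 ∧ Δ ⊓ A = ⊥ := by
  obtain ⟨D0, h1, h2, h3⟩ := ps_char_core hN D hD
  let Z : Subgroup T := D0.map f.ker.subtype
  have hZn : Z.Normal := ⟨by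
    rintro _ ⟨x, hx, rfl⟩ t
    exact ⟨MulAut.conjNormal t x, h3 (MulAut.conjNormal t) x hx, by simp⟩⟩
  have hZf : Z ≤ f.ker := by
    rintro _ ⟨x, _, rfl⟩
    exact x.2
  let fb : T ⧸ Z →* SurfaceGroup g := QuotientGroup.lift Z f hZf
  have hfb : Function.Surjective fb := by
    intro y
    obtain ⟨t, rfl⟩ := hf y
    exact ⟨(t : T ⧸ Z), rfl⟩
  have hfin : Finite fb.ker := by
    have : D0.FiniteIndex := ⟨h2⟩
    have : Finite (f.ker ⧸ D0) := Subgroup.finite_quotient_of_finiteIndex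
    let F : f.ker → fb.ker := fun x => ⟨((x : T) : T ⧸ Z), x.2⟩
    have hF : ∀ x y : f.ker, x⁻¹ * y ∈ D0 → F x = F y := by
      intro x y h
      apply Subtype.ext
      apply QuotientGroup.eq.2
      exact ⟨_, h, rfl⟩
    apply Finite.of_surjective (fun b : f.ker ⧸ D0 => F b.out)
    rintro ⟨y, hy⟩
    induction y using QuotientGroup.induction_on with
    | H t =>
      refine ⟨((⟨t, hy⟩ : f.ker) : f.ker ⧸ D0), ?_⟩
      exact hF _ ⟨t, hy⟩ (QuotientGroup.eq.1 (QuotientGroup.out_eq' _))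
  obtain ⟨Δ, h4, h5⟩ := ps_surface g hg fb hfb hfin
  refine ⟨Δ.comap (QuotientGroup.mk' Z), ?_, ?_⟩
  · rwa [Subgroup.index_comap_of_surjective _ (QuotientGroup.mk'_surjective Z)]
  · rw [eq_bot_iff]
    rintro a ⟨ha, haA⟩
    have h6 : (a : T ⧸ Z) ∈ Δ ⊓ fb.ker := ⟨ha, hA haA⟩
    rw [h5, Subgroup.mem_bot, QuotientGroup.eq_one_iff] at h6
    obtain ⟨x, hx, rfl⟩ := h6
    have := hDA x (h1 hx) haA
    rw [this]
    exact Subgroup.one_mem _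

theorem ps_surface_fg (g : ℕ) : Group.FG (SurfaceGroup g) :=
  Group.fg_of_surjective (PresentedGroup.mk_surjective ({surfaceRelator g} : Set (PSFree g)))

/-- The step, for a chain of subgroups. -/
theorem ps_chain_step {Γ : Type*} [Group Γ] (A P Q : Subgroup Γ) (hAP : A ≤ P) (hPQ : P ≤ Q)
    (g : ℕ) (hg : 2 ≤ g) (f : Q →* SurfaceGroup g) (hf : Function.Surjective f)
    (hker : f.ker = P.subgroupOf Q)
    (hP : P.FG) (D : Subgroup Γ) (hDP : D ≤ P) (hD : D.relIndex P ≠ 0) (hDA : D ⊓ A = ⊥) :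
    Q.FG ∧ ∃ D' : Subgroup Γ, D' ≤ Q ∧ D'.relIndex Q ≠ 0 ∧ D' ⊓ A = ⊥ := by
  let e : P ≃* f.ker := (Subgroup.subgroupOfEquivOfLe hPQ).symm.trans
    (MulEquiv.subgroupCongr hker.symm)
  have he : ∀ x : P, (((e x : f.ker) : Q) : Γ) = x := fun x => rfl
  have hPfg : Group.FG P := (Group.fg_iff_subgroup_fg P).2 hP
  have hN : Group.FG f.ker := Group.fg_of_surjective (f := e.toMonoidHom) e.surjective
  have hQ : Group.FG Q := ps_fg_ext f hf (ps_surface_fg g) ((Group.fg_iff_subgroup_fg _).1 hN)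
  refine ⟨(Group.fg_iff_subgroup_fg Q).1 hQ, ?_⟩
  obtain ⟨Δ, h1, h2⟩ := ps_step g hg f hf hN (A.subgroupOf Q)
    (by rw [hker]; exact Subgroup.comap_mono hAP)
    ((D.subgroupOf P).map e.toMonoidHom)
    (by
      rw [show (D.subgroupOf P).map e.toMonoidHom = (D.subgroupOf P).map (e : P →* f.ker) from rfl,
        Subgroup.index_map_equiv]
      exact hD)
    (by
      rintro _ ⟨x, hx, rfl⟩ hA
      have h1 : (x : Γ) ∈ D ⊓ A := ⟨hx, hA⟩
      rw [hDA, Subgroup.mem_bot] at h1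
      have : x = 1 := Subtype.ext h1
      rw [this, map_one])
  refine ⟨Δ.map Q.subtype, ?_, ?_, ?_⟩
  · rintro _ ⟨x, _, rfl⟩
    exact x.2
  · rw [Subgroup.relIndex, Subgroup.subgroupOf,
      Subgroup.comap_map_eq_self_of_injective Q.subtype_injective]
    exact h1
  · rw [eq_bot_iff]
    rintro _ ⟨⟨x, hx, rfl⟩, hA⟩
    have : x ∈ Δ ⊓ A.subgroupOf Q := ⟨hx, hA⟩
    rw [h2, Subgroup.mem_bot] at this
    rw [this]
    exact Subgroup.one_mem _

/-- Every central extension of a polysurface group `G` by a finite abelian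
group becomes trivial after passing to a finite-index subgroup of `G`. -/
theorem central_extension_of_polysurface_virtually_trivial
    {G Γ : Type*} [Group G] [Group Γ] {n : ℕ} (hn : 1 ≤ n)
    (hG : IsPolysurface G n)
    (φ : Γ →* G) (hφ : Function.Surjective φ)
    (hfin : Finite φ.ker) (hcentral : φ.ker ≤ Subgroup.center Γ) :
    ∃ W : Subgroup G, W.index ≠ 0 ∧
      ∃ s : W →* Γ, ∀ w : W, φ (s w) = (w : G) := by
  obtain ⟨Gs, h0, hlast, hmono, -, hstep⟩ := hG
  have hkerle : ∀ i, φ.ker ≤ (Gs i).comap φ := fun i x hx => by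
    rw [MonoidHom.mem_ker] at hx
    rw [Subgroup.mem_comap, hx]
    exact Subgroup.one_mem _
  have claim : ∀ i : Fin (n + 1), ((Gs i).comap φ).FG ∧ ∃ D : Subgroup Γ,
      D ≤ (Gs i).comap φ ∧ D.relIndex ((Gs i).comap φ) ≠ 0 ∧ D ⊓ φ.ker = ⊥ := by
    intro i
    induction i using Fin.induction with
    | zero =>
      have h1 : (Gs 0).comap φ = φ.ker := by rw [h0]; rfl
      rw [h1]
      refine ⟨(Group.fg_iff_subgroup_fg _).1 inferInstance, ⊥, bot_le, ?_, bot_inf_eq _⟩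
      rw [Subgroup.relIndex]
      exact Subgroup.index_ne_zero_of_finite
    | succ i ih =>
      obtain ⟨hfg, D, hD1, hD2, hD3⟩ := ih
      obtain ⟨g, hg, f, hf, hker⟩ := hstep i
      let c : (Gs i.succ).comap φ →* Gs i.succ := φ.subgroupComap (Gs i.succ)
      have hc : Function.Surjective c := by
        rintro ⟨y, hy⟩
        obtain ⟨x, rfl⟩ := hφ y
        exact ⟨⟨x, hy⟩, rfl⟩
      refine ps_chain_step φ.ker ((Gs i.castSucc).comap φ) ((Gs i.succ).comap φ) (hkerle _)
        (Subgroup.comap_mono (hmono (Fin.castSucc_le_succ i))) g hg (f.comp c) (hf.comp hc) ?_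
        hfg D hD1 hD2 hD3
      ext x
      have h2 : c x ∈ f.ker ↔ c x ∈ (Gs i.castSucc).subgroupOf (Gs i.succ) := by rw [hker]
      exact h2
  obtain ⟨-, D, -, hD, hDk⟩ := claim (Fin.last n)
  rw [hlast, Subgroup.comap_top, Subgroup.relIndex_top_right] at hD
  refine ⟨D.map φ, ne_zero_of_dvd_ne_zero hD (Subgroup.index_map_dvd _ hφ), ?_⟩
  let d : D →* D.map φ := φ.subgroupMap D
  have hd : Function.Bijective d := by
    refine ⟨(injective_iff_map_eq_one d).2 ?_, φ.subgroupMap_surjective D⟩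
    intro x hx
    have h1 : (x : Γ) ∈ D ⊓ φ.ker := ⟨x.2, congrArg Subtype.val hx⟩
    rw [hDk, Subgroup.mem_bot] at h1
    exact Subtype.ext h1
  let e := MulEquiv.ofBijective d hd
  refine ⟨D.subtype.comp e.symm.toMonoidHom, fun w => ?_⟩
  have := congrArg Subtype.val (e.apply_symm_apply w)
  exact this
end

section
/- Let A be a finite abelian group and let S be a surface group of genus g ≥ 2. Then every subgroup K of the direct product A × S that is isomorphic to S is the graph of a group homomorphism f : S → A, i.e., K = {(f(s), s) : s ∈ S}; consequently, the number of subgroups of A × S isomorphic to S is at most |A|^{2g}. -/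
namespace SurfAux

/-- A twisted homomorphism (noncommutative derivation) into functions on an `F`-set. -/
def IsCoc {F X E : Type*} [Group F] [MulAction F X] [Group E] (D : F → X → E) : Prop :=
  ∀ s t x, D (s * t) x = D s x * D t (s⁻¹ • x)

section coc
variable {F X E : Type*} [Group F] [MulAction F X] [Group E] {D : F → X → E}

theorem IsCoc.one (h : IsCoc D) (x : X) : D 1 x = 1 := by
  have := h 1 1 x
  simpa using this

theorem IsCoc.inv (h : IsCoc D) (s : F) (x : X) : D s⁻¹ x = (D s (s • x))⁻¹ := by
  have := h s⁻¹ s x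
  rw [inv_mul_cancel, h.one, inv_inv] at this
  exact eq_inv_of_mul_eq_one_left this.symm

/-- The elements acting trivially on which the cocycle vanishes. -/
def cocKer (h : IsCoc D) : Subgroup F where
  carrier := {n | (∀ x : X, n • x = x) ∧ ∀ x, D n x = 1}
  one_mem' := ⟨fun x => one_smul _ x, fun x => h.one x⟩
  mul_mem' := by
    rintro a b ⟨ha, ha'⟩ ⟨hb, hb'⟩
    exact ⟨fun x => by rw [mul_smul, hb, ha], fun x => by rw [h, ha', hb', one_mul]⟩
  inv_mem' := by
    rintro a ⟨ha, ha'⟩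
    exact ⟨fun x => by rw [inv_smul_eq_iff, ha], fun x => by rw [h.inv, ha', inv_one]⟩

instance cocKer_normal (h : IsCoc D) : (cocKer h).Normal where
  conj_mem := by
    rintro n ⟨hn, hn'⟩ w
    have hni : ∀ x : X, n⁻¹ • x = x := fun x => by rw [inv_smul_eq_iff, hn]
    refine ⟨fun x => by rw [mul_smul, mul_smul, hn, smul_inv_smul], fun x => ?_⟩
    rw [h, h, hn', h.inv, mul_inv_rev, mul_smul, hni, smul_inv_smul]
    simp

theorem coc_eq_of_normalClosure (h : IsCoc D) {r : F} (hr : ∀ x : X, r • x = x)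
    (hr' : ∀ x, D r x = 1) {n : F} (hn : n ∈ Subgroup.normalClosure {r}) (x : X) :
    D n x = 1 := by
  have : Subgroup.normalClosure {r} ≤ cocKer h := by
    apply Subgroup.normalClosure_le_normal
    rintro _ rfl
    exact ⟨hr, hr'⟩
  exact (this hn).2 x

end coc

theorem exists_coc {α X E : Type*} [MulAction (FreeGroup α) X] [Group E] (u : α → X → E) :
    ∃ D : FreeGroup α → X → E, IsCoc D ∧ ∀ j, D (FreeGroup.of j) = u j := by
  let W := (X → E) ⋊[mulAutArrow (G := FreeGroup α) (A := X) (M := E)] (FreeGroup α)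
  let Φ : FreeGroup α →* W := FreeGroup.lift fun j => ⟨u j, FreeGroup.of j⟩
  have hΦ : ∀ w, (Φ w).right = w := by
    intro w
    have : (SemidirectProduct.rightHom.comp Φ) = MonoidHom.id _ := by
      ext j
      simp [Φ]
    exact DFunLike.congr_fun this w
  refine ⟨fun w => (Φ w).left, ?_, fun j => by simp [Φ]⟩
  intro s t x
  have h1 : (Φ (s * t)).left = (Φ s).left * mulAutArrow (Φ s).right (Φ t).left := by
    rw [map_mul]
    exact SemidirectProduct.mul_left _ _
  change (Φ (s * t)).left x = _
  rw [h1, hΦ]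
  rfl

theorem coc_unique {α X E : Type*} [MulAction (FreeGroup α) X] [Group E]
    {D D' : FreeGroup α → X → E} (h : IsCoc D) (h' : IsCoc D')
    (hg : ∀ j x, D (FreeGroup.of j) x = D' (FreeGroup.of j) x) (w : FreeGroup α) (x : X) :
    D w x = D' w x := by
  induction w using FreeGroup.induction_on generalizing x with
  | C1 => rw [h.one, h'.one]
  | of j => exact hg j x
  | inv_of j ih => rw [h.inv, h'.inv, ih]
  | mul s t hs ht => rw [h, h', hs, ht]

/-- Flow lemma: on an infinite transitive set every function is a divergence. -/
theorem flow {G X J k : Type*} [Group G] [MulAction G X] [MulAction.IsPretransitive G X]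
    [Infinite X] [Field k] [Fintype J] (γ : J → G)
    (hγ : Subgroup.closure (Set.range γ) = ⊤) (f : X → k) :
    ∃ u : J → X → k, ∀ x, f x = ∑ j, (u j x - u j ((γ j)⁻¹ • x)) := by
  classical
  let T : (X →₀ k) →ₗ[k] (J → X →₀ k) :=
    LinearMap.pi fun j => LinearMap.id - Finsupp.lmapDomain k k (fun x => (γ j)⁻¹ • x)
  have hT : Function.Injective T := by
    rw [injective_iff_map_eq_zero]
    intro ξ hξ
    have h1 : ∀ j x, ξ (γ j • x) = ξ x := by
      intro j x
      have := congrFun hξ j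
      simp only [T, LinearMap.pi_apply, LinearMap.sub_apply, LinearMap.id_apply, Pi.zero_apply,
        sub_eq_zero, Finsupp.lmapDomain_apply] at this
      have h2 := Finsupp.mapDomain_apply (MulAction.injective ((γ j)⁻¹)) ξ (γ j • x)
      rw [inv_smul_smul] at h2
      rw [← h2, ← this]
    let K : Subgroup G :=
      { carrier := {s | ∀ x, ξ (s • x) = ξ x}
        one_mem' := fun x => by rw [one_smul]
        mul_mem' := fun {a b} ha hb x => by rw [mul_smul, ha, hb]
        inv_mem' := fun {a} ha x => by rw [← ha, smul_inv_smul] }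
    have hK : K = ⊤ := by
      rw [eq_top_iff, ← hγ, Subgroup.closure_le]
      rintro _ ⟨j, rfl⟩
      exact h1 j
    obtain ⟨y, hy⟩ := Infinite.exists_notMem_finset ξ.support
    ext x
    obtain ⟨s, rfl⟩ := MulAction.exists_smul_eq G y x
    have : s ∈ K := hK ▸ Subgroup.mem_top s
    rw [this y]
    simpa using hy
  have hs := LinearMap.dualMap_surjective_of_injective hT
  obtain ⟨Φ, hΦ⟩ := hs (Finsupp.linearCombination k f)
  refine ⟨fun j x => Φ (Pi.single j (Finsupp.single x 1)), fun x => ?_⟩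
  have h2 := LinearMap.congr_fun hΦ (Finsupp.single x 1)
  simp only [LinearMap.dualMap_apply, Finsupp.linearCombination_single, one_smul] at h2
  rw [← h2]
  simp only [← map_sub, ← Pi.single_sub, ← map_sum]
  congr 1
  ext j : 1
  rw [Finset.sum_apply, Finset.sum_eq_single j]
  · simp [T]
  · intro b _ hb
    simp [Pi.single_eq_of_ne (Ne.symm hb)]
  · simp

open scoped commutatorElement

/-- the commutators in the relator, extended by 1 -/
def cm (g : ℕ) (n : ℕ) : FreeGroup (Fin g × Bool) :=
  if h : n < g then ⁅FreeGroup.of ((⟨n, h⟩ : Fin g), true), FreeGroup.of ((⟨n, h⟩ : Fin g), false)⁆ else 1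

/-- partial products -/
def pp (g : ℕ) : ℕ → FreeGroup (Fin g × Bool)
  | 0 => 1
  | n + 1 => pp g n * cm g n

theorem pp_eq (g : ℕ) : pp g g = surfaceRelator g := by
  have h : ∀ n, pp g n = (List.ofFn fun i : Fin n => cm g i).prod := by
    intro n
    induction n with
    | zero => simp [pp]
    | succ n ih =>
      rw [List.ofFn_succ', List.concat_eq_append, List.prod_append, pp, ih]
      simp
  rw [h, surfaceRelator]
  congr 2
  funext i
  simp [cm]

theorem solve {g : ℕ} {X k : Type*} [MulAction (FreeGroup (Fin g × Bool)) X]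
    [MulAction.IsPretransitive (FreeGroup (Fin g × Bool)) X] [Infinite X] [Field k]
    (f : X → k) :
    ∃ D : FreeGroup (Fin g × Bool) → X → Multiplicative k, IsCoc D ∧
      ∀ x, D (surfaceRelator g) x = Multiplicative.ofAdd (f x) := by
  let a : Fin g → FreeGroup (Fin g × Bool) := fun i => FreeGroup.of (i, true)
  let b : Fin g → FreeGroup (Fin g × Bool) := fun i => FreeGroup.of (i, false)
  let s : Fin g × Bool → FreeGroup (Fin g × Bool) := fun j =>
    if j.2 then pp g j.1 else pp g j.1 * a j.1
  let t : Fin g × Bool → FreeGroup (Fin g × Bool) := fun j =>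
    if j.2 then pp g j.1 * a j.1 * b j.1 * (a j.1)⁻¹ else pp g j.1 * ⁅a j.1, b j.1⁆
  have hcl : Subgroup.closure (Set.range fun j => t j * (s j)⁻¹) = ⊤ := by
    set K := Subgroup.closure (Set.range fun j => t j * (s j)⁻¹) with hK
    have h1 : ∀ i : Fin g, pp g i ∈ K → a i ∈ K ∧ b i ∈ K := by
      intro i hp
      have e1 : t (i, true) * (s (i, true))⁻¹ ∈ K := Subgroup.subset_closure ⟨_, rfl⟩
      have e2 : t (i, false) * (s (i, false))⁻¹ ∈ K := Subgroup.subset_closure ⟨_, rfl⟩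
      have e3 : a i * b i * (a i)⁻¹ ∈ K := by
        have := K.mul_mem (K.mul_mem (K.inv_mem hp) e1) hp
        simpa [s, t, mul_assoc] using this
      have e4 : a i * b i * (a i)⁻¹ * (b i)⁻¹ * (a i)⁻¹ ∈ K := by
        have := K.mul_mem (K.mul_mem (K.inv_mem hp) e2) hp
        simpa [s, t, mul_assoc, commutatorElement_def] using this
      have e5 : a i * b i ∈ K := by
        have := K.mul_mem (K.inv_mem e4) e3
        simpa [mul_assoc] using this
      have e6 : a i ∈ K := by
        have := K.mul_mem (K.inv_mem e3) e5
        simpa [mul_assoc] using this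
      exact ⟨e6, by simpa using K.mul_mem (K.inv_mem e6) e5⟩
    have h2 : ∀ n, pp g n ∈ K := by
      intro n
      induction n with
      | zero => exact K.one_mem
      | succ n ih =>
        refine K.mul_mem ih ?_
        unfold cm
        split_ifs with h
        · obtain ⟨ha, hb⟩ := h1 ⟨n, h⟩ ih
          rw [commutatorElement_def]
          exact K.mul_mem (K.mul_mem (K.mul_mem ha hb) (K.inv_mem ha)) (K.inv_mem hb)
        · exact K.one_mem
    rw [eq_top_iff, ← FreeGroup.closure_range_of, Subgroup.closure_le]
    rintro _ ⟨⟨i, c⟩, rfl⟩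
    cases c
    · exact (h1 i (h2 i)).2
    · exact (h1 i (h2 i)).1
  obtain ⟨u, hu⟩ := flow (fun j => t j * (s j)⁻¹) hcl f
  obtain ⟨D, hD, hDu⟩ := exists_coc (fun j x => Multiplicative.ofAdd (u j (s j • x)))
  refine ⟨D, hD, ?_⟩
  have hDa : ∀ i x, D (a i) x = Multiplicative.ofAdd (u (i, true) (s (i, true) • x)) :=
    fun i x => by rw [hDu]
  have hDb : ∀ i x, D (b i) x = Multiplicative.ofAdd (u (i, false) (s (i, false) • x)) :=
    fun i x => by rw [hDu]
  have hc : ∀ (i : Fin g) x, D (cm g i) ((pp g i)⁻¹ • x) = Multiplicative.ofAdd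
      (∑ c : Bool, (u (i, c) x - u (i, c) ((t (i, c) * (s (i, c))⁻¹)⁻¹ • x))) := by
    intro i x
    have : cm g i = a i * b i * (a i)⁻¹ * (b i)⁻¹ := by simp [cm, commutatorElement_def, a, b]
    rw [this, hD, hD, hD, hD.inv, hD.inv, hDa, hDa, hDb, hDb]
    simp only [Fintype.sum_bool, ← ofAdd_add, ← ofAdd_neg, s, t, if_true,
      smul_smul, commutatorElement_def, mul_inv_rev, inv_inv, Bool.false_eq_true, if_false]
    congr 1
    have e1 : ∀ v : Bool → X → k, ∀ x1 x2 x3 x4 y3 y4 : FreeGroup (Fin g × Bool), x1 = 1 →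
      x2 = 1 → x3 = y3 → x4 = y4 → v true (x1 • x) + v false (x2 • x) + - v true (x3 • x) +
        -v false (x4 • x) = (v true x - v true (y3 • x)) +
        (v false x - v false (y4 • x)) := by
      rintro v _ _ _ _ _ _ rfl rfl rfl rfl
      rw [one_smul]
      ring
    apply e1 (fun c => u (i, c)) <;> group
  have hsum : ∀ n ≤ g, ∀ x, D (pp g n) x = ∏ i ∈ Finset.range n, D (cm g i) ((pp g i)⁻¹ • x) := by
    intro n hn x
    induction n with
    | zero => simpa [pp] using hD.one x
    | succ n ih =>
      rw [pp, hD, ih (by omega), Finset.prod_range_succ]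
  intro x
  rw [← pp_eq, hsum g le_rfl, Finset.prod_range]
  simp only [hc, ← ofAdd_sum]
  rw [hu x, Fintype.sum_prod_type]

end SurfAux

namespace SurfAux

/-- the projection from the free group -/
abbrev pr (g : ℕ) : FreeGroup (Fin g × Bool) →* SurfaceGroup g :=
  PresentedGroup.mk ({surfaceRelator g} : Set (FreeGroup (Fin g × Bool)))

theorem pr_rel (g : ℕ) : pr g (surfaceRelator g) = 1 :=
  PresentedGroup.one_of_mem rfl

/-- action of the free group on cosets -/
@[reducible] def cosetAct (g : ℕ) (H : Subgroup (SurfaceGroup g)) :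
    MulAction (FreeGroup (Fin g × Bool)) (SurfaceGroup g ⧸ H) :=
  MulAction.compHom _ (pr g)

theorem out_mem {G : Type*} [Group G] (H : Subgroup G) (s : G) (x : G ⧸ H) :
    (Quotient.out x)⁻¹ * s * Quotient.out (s⁻¹ • x) ∈ H := by
  rw [mul_assoc, ← QuotientGroup.eq]
  have h1 : ((s * Quotient.out (s⁻¹ • x) : G) : G ⧸ H) =
    s • ((Quotient.out (s⁻¹ • x) : G) : G ⧸ H) := rfl
  rw [h1, QuotientGroup.out_eq', QuotientGroup.out_eq', smul_inv_smul]

/-- Second cohomology of infinite-index subgroups vanishes. -/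
theorem lift_of_infinite {g : ℕ} (H : Subgroup (SurfaceGroup g))
    [Infinite (SurfaceGroup g ⧸ H)] {k E Q : Type*} [Field k] [Group E] [Group Q]
    (q : E →* Q) (hq : Function.Surjective q) (ι : Multiplicative k →* E)
    (hι : ∀ e, q e = 1 → ∃ c, ι c = e) (hι' : ∀ c, q (ι c) = 1)
    (hc : ∀ c e, ι c * e = e * ι c) (φ : H →* Q) :
    ∃ ψ : H →* E, ∀ h, q (ψ h) = φ h := by
  let := cosetAct g H
  have hact : ∀ (w : FreeGroup (Fin g × Bool)) (x : SurfaceGroup g ⧸ H), w • x = pr g w • x :=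
    fun _ _ => rfl
  have : MulAction.IsPretransitive (FreeGroup (Fin g × Bool)) (SurfaceGroup g ⧸ H) := by
    constructor
    intro x y
    obtain ⟨s, hs⟩ := MulAction.exists_smul_eq (SurfaceGroup g) x y
    obtain ⟨w, rfl⟩ := PresentedGroup.mk_surjective _ s
    exact ⟨w, hs⟩
  let Θ : FreeGroup (Fin g × Bool) → (SurfaceGroup g ⧸ H) → Q := fun w x =>
    φ ⟨_, out_mem H (pr g w) x⟩
  have hΘ : IsCoc Θ := by
    intro s t x
    simp only [Θ, ← map_mul, hact]
    congr 1
    ext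
    simp only [map_mul, map_inv, Subgroup.coe_mul, mul_inv_rev, mul_smul]
    group
  have hlift : ∀ j x, ∃ e, q e = Θ (FreeGroup.of j) x := fun j x => hq _
  choose e he using hlift
  obtain ⟨Ψ, hΨ, hΨe⟩ := exists_coc e
  have hqΨ : ∀ w x, q (Ψ w x) = Θ w x := by
    have h1 : IsCoc (fun w x => q (Ψ w x)) := fun s t x => by simp only [hΨ s t x, map_mul]
    exact coc_unique h1 hΘ fun j x => by rw [hΨe, he]
  have hΘr : ∀ x, Θ (surfaceRelator g) x = 1 := by
    intro x
    rw [← map_one φ]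
    simp only [Θ]
    congr 1
    ext
    simp [pr_rel]
  have hm : ∀ x, ∃ c, ι c = Ψ (surfaceRelator g) x := fun x => hι _ (by rw [hqΨ, hΘr])
  choose m hm using hm
  obtain ⟨D, hD, hDr⟩ := solve (g := g) (fun x => - Multiplicative.toAdd (m x))
  let Ψ' : FreeGroup (Fin g × Bool) → (SurfaceGroup g ⧸ H) → E := fun w x => ι (D w x) * Ψ w x
  have hΨ' : IsCoc Ψ' := by
    intro s t x
    simp only [Ψ', hD s t x, hΨ s t x, map_mul]
    rw [mul_assoc, ← mul_assoc (ι _) (Ψ s x), hc _ (Ψ s x)]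
    simp only [mul_assoc]
  have hqΨ' : ∀ w x, q (Ψ' w x) = Θ w x := fun w x => by simp [Ψ', hι', hqΨ]
  have hr : ∀ x, Ψ' (surfaceRelator g) x = 1 := by
    intro x
    simp only [Ψ', ← hm, ← map_mul, hDr, ofAdd_neg, ofAdd_toAdd, inv_mul_cancel, map_one]
  have hker : ∀ w w', pr g w = pr g w' → ∀ x, Ψ' w x = Ψ' w' x := by
    intro w w' hw x
    have h1 : w * w'⁻¹ ∈ Subgroup.normalClosure {surfaceRelator g} := by
      rw [← PresentedGroup.mk_eq_one_iff, map_mul, map_inv]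
      exact mul_inv_eq_one.mpr hw
    have h2 := coc_eq_of_normalClosure hΨ' (fun x => by rw [hact, pr_rel, one_smul]) hr h1 x
    have h3 := hΨ' (w * w'⁻¹) w' x
    rw [inv_mul_cancel_right, h2, one_mul] at h3
    rw [h3, hact, map_inv, map_mul, map_inv, hw]
    simp
  choose sec hsec using PresentedGroup.mk_surjective
    ({surfaceRelator g} : Set (FreeGroup (Fin g × Bool)))
  let x0 : SurfaceGroup g ⧸ H := ((1 : SurfaceGroup g) : SurfaceGroup g ⧸ H)
  have hx0 : ∀ h ∈ H, h • x0 = x0 := by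
    intro h hh
    change ((h * 1 : SurfaceGroup g) : SurfaceGroup g ⧸ H) = _
    rw [QuotientGroup.eq]
    simpa using hh
  let ψ : H →* E := MonoidHom.mk' (fun h => Ψ' (sec h) x0) (by
    intro a b
    have h1 : Ψ' (sec ((a * b : H) : SurfaceGroup g)) x0 = Ψ' (sec a * sec b) x0 := by
      apply hker
      rw [map_mul, hsec, hsec, hsec]
      rfl
    rw [h1, hΨ', hact, map_inv, hsec, hx0 _ (H.inv_mem a.2)])
  have ht : Quotient.out x0 ∈ H := by
    have : ((Quotient.out x0 : SurfaceGroup g) : SurfaceGroup g ⧸ H) = (1 : SurfaceGroup g) :=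
      QuotientGroup.out_eq' x0
    rw [eq_comm, QuotientGroup.eq] at this
    simpa using this
  obtain ⟨e0, he0⟩ := hq (φ ⟨_, ht⟩)
  refine ⟨(MulAut.conj e0).toMonoidHom.comp ψ, fun h => ?_⟩
  have h1 : q (ψ h) = φ (⟨_, ht⟩⁻¹ * h * ⟨_, ht⟩) := by
    change q (Ψ' (sec h) x0) = _
    rw [hqΨ']
    simp only [Θ]
    congr 1
    ext
    simp only [hsec, hx0 _ (H.inv_mem h.2)]
    rfl
  simp only [MonoidHom.comp_apply, MulEquiv.coe_toMonoidHom, MulAut.conj_apply, map_mul, map_inv, h1,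
    he0]
  group

theorem card_gens_infinite {g : ℕ} (hg : 1 ≤ g) : Infinite (SurfaceGroup g) := by
  let f : SurfaceGroup g →* Multiplicative ℤ := PresentedGroup.toGroup
    (f := fun _ => Multiplicative.ofAdd 1) (by
      rintro _ rfl
      rw [surfaceRelator, map_list_prod, List.map_ofFn]
      apply List.prod_eq_one
      intro x hx
      rw [List.mem_ofFn] at hx
      obtain ⟨i, rfl⟩ := hx
      simp [commutatorElement_def])
  apply Infinite.of_surjective f
  intro z
  refine ⟨(PresentedGroup.of (⟨0, hg⟩, true)) ^ (Multiplicative.toAdd z), ?_⟩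
  rw [map_zpow, PresentedGroup.toGroup.of, ← ofAdd_zsmul]
  simp

theorem torsion_prime {g : ℕ} (hg : 1 ≤ g) (p : ℕ) [hp : Fact p.Prime] (t : SurfaceGroup g)
    (ht : orderOf t = p) : False := by
  let H := Subgroup.zpowers t
  have hfin : Finite H := by
    apply Nat.finite_of_card_ne_zero
    rw [Nat.card_zpowers, ht]
    exact hp.out.ne_zero
  have hinf : Infinite (SurfaceGroup g ⧸ H) := by
    by_contra h
    rw [not_infinite_iff_finite] at h
    have := card_gens_infinite hg
    have h2 : Finite ((SurfaceGroup g ⧸ H) × H) := inferInstance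
    have h3 := Finite.of_equiv _ (Subgroup.groupEquivQuotientProdSubgroup (s := H)).symm
    exact not_finite (SurfaceGroup g)
  have hp2 : p ∣ p ^ 2 := Dvd.intro_left (p ^ 1) rfl
  let q : Multiplicative (ZMod (p ^ 2)) →* Multiplicative (ZMod p) :=
    (ZMod.castHom hp2 (ZMod p)).toAddMonoidHom.toMultiplicative
  have : NeZero p := ⟨hp.out.ne_zero⟩
  have : NeZero (p ^ 2) := ⟨pow_ne_zero _ hp.out.ne_zero⟩
  have hq : Function.Surjective q := ZMod.castHom_surjective hp2
  let ι0 : ZMod p →+ ZMod (p ^ 2) := ZMod.lift p ⟨(AddMonoidHom.mulLeft (p : ZMod (p ^ 2))).comp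
    (Int.castAddHom _), by
      simp only [AddMonoidHom.comp_apply, AddMonoidHom.coe_mulLeft, Int.coe_castAddHom]
      have := ZMod.natCast_self (p ^ 2)
      push_cast at this ⊢
      rw [← this]
      ring⟩
  have hι0 : ∀ z : ℤ, ι0 (z : ZMod p) = p * (z : ZMod (p ^ 2)) := fun z => by
    simp [ι0]
  have hker : ∀ y : ZMod (p ^ 2), ZMod.castHom hp2 (ZMod p) y = 0 → ∃ z : ℤ, y = p * z := by
    intro y hy
    obtain ⟨n, rfl⟩ := ZMod.intCast_surjective y
    rw [map_intCast, ZMod.intCast_zmod_eq_zero_iff_dvd] at hy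
    obtain ⟨z, rfl⟩ := hy
    exact ⟨z, by push_cast; rfl⟩
  let t' : H := ⟨t, Subgroup.mem_zpowers t⟩
  have hgen : ∀ x : H, x ∈ Subgroup.zpowers t' := by
    rintro ⟨x, n, rfl⟩
    exact ⟨n, rfl⟩
  have hn : Nat.card H = p := by rw [Nat.card_zpowers, ht]
  let φ : H →* Multiplicative (ZMod p) := (zmodMulEquivOfGenerator hgen hn).symm.toMonoidHom
  have hφ : φ t' = Multiplicative.ofAdd 1 := zmodMulEquivOfGenerator_symm_apply_generator hgen hn
  obtain ⟨ψ, hψ⟩ := lift_of_infinite H q hq ι0.toMultiplicative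
    (fun e he => by
      obtain ⟨z, hz⟩ := hker e.toAdd he
      refine ⟨Multiplicative.ofAdd (z : ZMod p), ?_⟩
      apply Multiplicative.toAdd.injective
      rw [hz]
      exact hι0 z)
    (fun c => by
      obtain ⟨z, hz⟩ := ZMod.intCast_surjective c.toAdd
      change Multiplicative.ofAdd (ZMod.castHom hp2 (ZMod p) (ι0 c.toAdd)) = 1
      rw [← hz, hι0, map_mul, map_natCast, ZMod.natCast_self, zero_mul]
      rfl)
    (fun c e => mul_comm _ _) φ
  have h1 := hψ t'
  rw [hφ] at h1
  obtain ⟨n, hn'⟩ := ZMod.intCast_surjective (ψ t').toAdd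
  have h2 : t' ^ p = 1 := by
    ext
    simp only [Subgroup.coe_pow, t', ← ht, pow_orderOf_eq_one, Subgroup.coe_one]
  have h3 : (p : ZMod (p ^ 2)) * n = 0 := by
    have : (ψ t') ^ p = 1 := by rw [← map_pow, h2, map_one]
    have := congrArg Multiplicative.toAdd this
    rw [toAdd_pow, ← hn', toAdd_one, nsmul_eq_mul] at this
    exact this
  have h4 : (p : ℤ) ∣ n := by
    have h5 : (((p * n : ℤ)) : ZMod (p ^ 2)) = 0 := by push_cast; exact h3
    rw [ZMod.intCast_zmod_eq_zero_iff_dvd] at h5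
    push_cast at h5
    rw [pow_two] at h5
    exact Int.dvd_of_mul_dvd_mul_left (by exact_mod_cast hp.out.ne_zero) h5
  have h5 : ZMod.castHom hp2 (ZMod p) (ψ t').toAdd = 1 := congrArg Multiplicative.toAdd h1
  rw [← hn', map_intCast, (ZMod.intCast_zmod_eq_zero_iff_dvd n p).mpr h4] at h5
  exact zero_ne_one h5

theorem torsion_free {g : ℕ} (hg : 1 ≤ g) (t : SurfaceGroup g) (n : ℕ) (hn : 0 < n)
    (ht : t ^ n = 1) : t = 1 := by
  by_contra h
  have hfo : 0 < orderOf t := orderOf_pos_iff.mpr (isOfFinOrder_iff_pow_eq_one.mpr ⟨n, hn, ht⟩)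
  have h1 : orderOf t ≠ 1 := fun h' => h (orderOf_eq_one_iff.mp h')
  have hp := Nat.minFac_prime h1
  have : Fact (orderOf t).minFac.Prime := ⟨hp⟩
  exact torsion_prime hg _ (t ^ (orderOf t / (orderOf t).minFac))
    (orderOf_pow_orderOf_div hfo.ne' (Nat.minFac_dvd _))

/-- projection from the dihedral group of order 8 to the four-group -/
def dq : DihedralGroup 4 →* DihedralGroup 2 where
  toFun
    | .r i => .r (ZMod.castHom (by norm_num : 2 ∣ 4) (ZMod 2) i)
    | .sr i => .sr (ZMod.castHom (by norm_num : 2 ∣ 4) (ZMod 2) i)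
  map_one' := by decide
  map_mul' := by decide

/-- inclusion of the centre -/
def di : Multiplicative (ZMod 2) →* DihedralGroup 4 where
  toFun c := .r (2 * (ZMod.val c.toAdd : ZMod 4))
  map_one' := by decide
  map_mul' := by decide

open scoped commutatorElement

/-- A nontrivial class in second cohomology. -/
theorem nolift {g : ℕ} (hg : 1 ≤ g) : ∃ φ : SurfaceGroup g →* DihedralGroup 2,
    ¬ ∃ ψ : SurfaceGroup g →* DihedralGroup 4, ∀ h, dq (ψ h) = φ h := by
  obtain ⟨n, rfl⟩ : ∃ n, g = n + 1 := ⟨g - 1, by omega⟩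
  let v : Fin (n + 1) × Bool → DihedralGroup 2 := fun j =>
    if j.1 = 0 then (if j.2 then .r 1 else .sr 0) else 1
  have hcomm : ∀ a b : DihedralGroup 2, ⁅a, b⁆ = 1 := by decide
  let φ : SurfaceGroup (n + 1) →* DihedralGroup 2 := PresentedGroup.toGroup (f := v) (by
      rintro _ rfl
      rw [surfaceRelator, map_list_prod, List.map_ofFn]
      apply List.prod_eq_one
      intro x hx
      rw [List.mem_ofFn] at hx
      obtain ⟨i, rfl⟩ := hx
      simp only [Function.comp_apply, map_commutatorElement, hcomm])
  have hφ : ∀ j, φ (PresentedGroup.of j) = v j := fun j => PresentedGroup.toGroup.of _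
  refine ⟨φ, ?_⟩
  rintro ⟨ψ, hψ⟩
  have h1 : ψ (pr (n + 1) (List.ofFn fun i : Fin (n + 1) =>
      ⁅FreeGroup.of (i, true), FreeGroup.of (i, false)⁆).prod) = 1 := by
    change ψ (pr (n + 1) (surfaceRelator (n + 1))) = 1
    rw [pr_rel, map_one]
  rw [map_list_prod, List.map_ofFn, map_list_prod, List.map_ofFn, List.ofFn_succ,
    List.prod_cons] at h1
  have d1 : ∀ a b : DihedralGroup 4, dq a = 1 → dq b = 1 → ⁅a, b⁆ = 1 := by decide
  have d2 : ∀ a b : DihedralGroup 4, dq a = .r 1 → dq b = .sr 0 → ⁅a, b⁆ ≠ 1 := by decide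
  rw [List.prod_eq_one, mul_one] at h1
  · simp only [Function.comp_apply, map_commutatorElement] at h1
    refine d2 _ _ ?_ ?_ h1
    · rw [hψ]; exact (hφ _).trans (by simp [v])
    · rw [hψ]; exact (hφ _).trans (by simp [v])
  · intro x hx
    rw [List.mem_ofFn] at hx
    obtain ⟨i, rfl⟩ := hx
    simp only [Function.comp_apply, map_commutatorElement]
    apply d1
    · rw [hψ]; exact (hφ _).trans (by simp [v])
    · rw [hψ]; exact (hφ _).trans (by simp [v])

theorem finite_index_of_equiv {g : ℕ} (hg : 1 ≤ g) (H : Subgroup (SurfaceGroup g))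
    (e : H ≃* SurfaceGroup g) : Finite (SurfaceGroup g ⧸ H) := by
  by_contra h
  rw [not_finite_iff_infinite] at h
  obtain ⟨φ, hφ⟩ := nolift hg
  obtain ⟨ψ, hψ⟩ := lift_of_infinite H dq (by decide) di (by decide) (by decide) (by decide)
    (φ.comp e.toMonoidHom)
  exact hφ ⟨ψ.comp e.symm.toMonoidHom, fun h => by simp [hψ]⟩

theorem index_one_of_equiv {g : ℕ} (hg : 2 ≤ g) (H : Subgroup (SurfaceGroup g))
    (e : H ≃* SurfaceGroup g) : H = ⊤ := by
  classical
  have hfin := finite_index_of_equiv (by omega) H e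
  have hF := Fintype.ofFinite (SurfaceGroup g ⧸ H)
  let := cosetAct g H
  have hact : ∀ (w : FreeGroup (Fin g × Bool)) (x : SurfaceGroup g ⧸ H), w • x = pr g w • x :=
    fun _ _ => rfl
  let k := Multiplicative (ZMod 2)
  have hD : ∀ u : Fin g × Bool → (SurfaceGroup g ⧸ H) → k, ∃ D, IsCoc D ∧
    ∀ j, D (FreeGroup.of j) = u j := fun u => exists_coc u
  choose D hDc hDu using hD
  choose sec hsec using PresentedGroup.mk_surjective
    ({surfaceRelator g} : Set (FreeGroup (Fin g × Bool)))
  let x0 : SurfaceGroup g ⧸ H := ((1 : SurfaceGroup g) : SurfaceGroup g ⧸ H)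
  have hx0 : ∀ h ∈ H, h • x0 = x0 := by
    intro h hh
    change ((h * 1 : SurfaceGroup g) : SurfaceGroup g ⧸ H) = _
    rw [QuotientGroup.eq]
    simpa using hh
  let σ : SurfaceGroup g ⧸ H → FreeGroup (Fin g × Bool) := fun x => sec (Quotient.out x)
  have hσ : ∀ x, pr g (σ x) = Quotient.out x := fun x => hsec _
  have hσx : ∀ x, (σ x)⁻¹ • x = x0 := by
    intro x
    rw [inv_smul_eq_iff, hact, hσ]
    change x = ((Quotient.out x * 1 : SurfaceGroup g) : SurfaceGroup g ⧸ H)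
    rw [mul_one, QuotientGroup.out_eq']
  let η : Fin g × Bool → FreeGroup (Fin g × Bool) := fun j =>
    sec (e.symm (PresentedGroup.of j) : H)
  let T : (Fin g × Bool → (SurfaceGroup g ⧸ H) → k) →
      ((SurfaceGroup g ⧸ H) → k) × (Fin g × Bool → k) × ({x // x ≠ x0} → k) := fun u =>
    (D u (surfaceRelator g), fun j => D u (η j) x0, fun x => D u (σ x) x)
  have hT : Function.Injective T := by
    intro u u' huu
    simp only [T, Prod.mk.injEq] at huu
    obtain ⟨e1, e2, e3⟩ := huu
    let B : FreeGroup (Fin g × Bool) → (SurfaceGroup g ⧸ H) → k := fun w x =>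
      D u w x * (D u' w x)⁻¹
    have hB : IsCoc B := by
      intro s t x
      simp only [B, hDc u s t x, hDc u' s t x, mul_inv]
      exact mul_mul_mul_comm _ _ _ _
    have b1 : ∀ x, B (surfaceRelator g) x = 1 := fun x =>
      mul_inv_eq_one.mpr (congrFun e1 x)
    have b2 : ∀ j, B (η j) x0 = 1 := fun j => mul_inv_eq_one.mpr (congrFun e2 j)
    have b3 : ∀ x, x ≠ x0 → B (σ x) x = 1 := fun x hx =>
      mul_inv_eq_one.mpr (congrFun e3 ⟨x, hx⟩)
    have hker : ∀ w w', pr g w = pr g w' → ∀ x, B w x = B w' x := by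
      intro w w' hw x
      have h1 : w * w'⁻¹ ∈ Subgroup.normalClosure {surfaceRelator g} := by
        rw [← PresentedGroup.mk_eq_one_iff, map_mul, map_inv]
        exact mul_inv_eq_one.mpr hw
      have h2 := coc_eq_of_normalClosure hB (fun x => by rw [hact, pr_rel, one_smul]) b1 h1 x
      have h3 := hB (w * w'⁻¹) w' x
      rw [inv_mul_cancel_right, h2, one_mul] at h3
      rw [h3, hact, map_inv, map_mul, map_inv, hw]
      simp
    -- the restriction to `H`
    let β : H →* k := MonoidHom.mk' (fun h => B (sec h) x0) (by
      intro a b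
      have h1 : B (sec ((a * b : H) : SurfaceGroup g)) x0 = B (sec a * sec b) x0 := by
        apply hker
        rw [map_mul, hsec, hsec, hsec]
        rfl
      rw [h1, hB, hact, map_inv, hsec, hx0 _ (H.inv_mem a.2)])
    have hβ : ∀ s, (β.comp e.symm.toMonoidHom) s = 1 := by
      intro s
      exact PresentedGroup.generated_by _ (β.comp e.symm.toMonoidHom).ker (fun j => b2 j) s
    have b4 : ∀ w, pr g w ∈ H → B w x0 = 1 := by
      intro w hw
      have h1 := hβ (e ⟨_, hw⟩)
      simp only [MonoidHom.comp_apply, MulEquiv.coe_toMonoidHom, MulEquiv.symm_apply_apply] at h1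
      rw [← h1]
      exact hker _ _ (hsec _).symm _
    have b5 : ∀ x, B (σ x) x = 1 := by
      intro x
      by_cases hx : x = x0
      · subst hx
        apply b4
        rw [hσ]
        have : ((Quotient.out x0 : SurfaceGroup g) : SurfaceGroup g ⧸ H) = (1 : SurfaceGroup g) :=
          QuotientGroup.out_eq' x0
        rw [eq_comm, QuotientGroup.eq] at this
        simpa using this
      · exact b3 x hx
    have b6 : ∀ w x, B w x = 1 := by
      intro w x
      have h1 : B ((σ x)⁻¹ * w * σ (w⁻¹ • x)) x0 = 1 := by
        apply b4
        rw [map_mul, map_mul, map_inv, hσ, hσ, hact, map_inv]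
        exact out_mem H _ _
      have h2 := hB (σ x) ((σ x)⁻¹ * w * σ (w⁻¹ • x)) x
      rw [hσx, h1, b5, mul_assoc, mul_inv_cancel_left, hB, b5, mul_one, mul_one] at h2
      exact h2
    funext j x
    rw [← hDu u, ← hDu u']
    exact mul_inv_eq_one.mp (b6 _ _)
  have hcard := Fintype.card_le_of_injective T hT
  have hk : Fintype.card k = 2 := rfl
  simp only [Fintype.card_fun, Fintype.card_prod, Fintype.card_fin, Fintype.card_bool, hk,
    Fintype.card_subtype_compl, Fintype.card_unique, ← pow_mul, ← pow_add, ne_eq] at hcard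
  have hle := (Nat.pow_le_pow_iff_right (by norm_num)).mp hcard
  have hd : 0 < Fintype.card (SurfaceGroup g ⧸ H) := Fintype.card_pos
  rw [← Subgroup.index_eq_one, Subgroup.index, Nat.card_eq_fintype_card]
  generalize Fintype.card (SurfaceGroup g ⧸ H) = d at *
  by_contra hd1
  obtain ⟨d', rfl⟩ : ∃ d', d = d' + 2 := ⟨d - 2, by omega⟩
  obtain ⟨g', rfl⟩ : ∃ g', g = g' + 2 := ⟨g - 2, by omega⟩
  simp at hle
  nlinarith

end SurfAux
/-- If `A` is a finite abelian group and `S` is a surface group of genus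
`g ≥ 2`, then every subgroup `K` of `A × S` isomorphic to `S` is the graph
`{(f s, s) : s ∈ S}` of a homomorphism `f : S → A`; consequently, the number of
subgroups of `A × S` isomorphic to `S` is at most `|A|^(2g)`. -/
theorem subgroup_of_prod_iso_surface_group_is_graph
    {A S : Type*} [CommGroup A] [Finite A] [Group S] {g : ℕ}
    (hS : IsSurfaceGroup S g) (hg : 2 ≤ g) :
    (∀ K : Subgroup (A × S), Nonempty (K ≃* S) →
      ∃ f : S →* A, (K : Set (A × S)) = Set.range fun s : S => (f s, s)) ∧
    Nat.card {K : Subgroup (A × S) // Nonempty (K ≃* S)} ≤ Nat.card A ^ (2 * g) := by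

  obtain ⟨e⟩ := hS
  have key : ∀ K : Subgroup (A × S), Nonempty (K ≃* S) →
      ∃ f : S →* A, (K : Set (A × S)) = Set.range fun s : S => (f s, s) := by
    rintro K ⟨c⟩
    let π : K →* SurfaceGroup g := e.toMonoidHom.comp ((MonoidHom.snd A S).comp K.subtype)
    have hπ : Function.Injective π := by
      rw [injective_iff_map_eq_one]
      rintro ⟨⟨a, s⟩, hK⟩ h
      have hs : s = 1 := by simpa [π] using h
      subst hs
      have h1 : e (c ⟨(a, 1), hK⟩) = 1 := by
        apply SurfAux.torsion_free (by omega) _ (Nat.card A) Nat.card_pos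
        rw [← map_pow, ← map_pow]
        have : (⟨(a, 1), hK⟩ : K) ^ (Nat.card A) = 1 := by
          ext <;> simp
        rw [this, map_one, map_one]
      simpa using h1
    have htop := SurfAux.index_one_of_equiv hg π.range
      ((MonoidHom.ofInjective hπ).symm.trans (c.trans e))
    have hsurj : Function.Surjective π := MonoidHom.range_eq_top.mp htop
    let E : K ≃* S := (MulEquiv.ofBijective π ⟨hπ, hsurj⟩).trans e.symm
    have hE : ∀ x : K, E x = x.1.2 := fun x => by simp [E, π]
    refine ⟨(MonoidHom.fst A S).comp (K.subtype.comp E.symm.toMonoidHom), ?_⟩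
    have hE' : ∀ s, (E.symm s).1.2 = s := fun s => by rw [← hE, E.apply_symm_apply]
    ext x
    constructor
    · intro hx
      refine ⟨x.2, ?_⟩
      have : E.symm x.2 = ⟨x, hx⟩ := by rw [MulEquiv.symm_apply_eq, hE]
      simp [this]
    · rintro ⟨s, rfl⟩
      have : ((E.symm s).1.1, s) = (E.symm s).1 := Prod.ext rfl (hE' s).symm
      change ((E.symm s).1.1, s) ∈ K
      rw [this]
      exact (E.symm s).2
  refine ⟨key, ?_⟩
  choose f hf using key
  let T : {K : Subgroup (A × S) // Nonempty (K ≃* S)} → (Fin g × Bool → A) := fun K j =>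
    f K.1 K.2 (e.symm (PresentedGroup.of j))
  have hT : Function.Injective T := by
    intro K K' h
    have h1 : (f K.1 K.2).comp e.symm.toMonoidHom = (f K'.1 K'.2).comp e.symm.toMonoidHom :=
      PresentedGroup.ext fun j => congrFun h j
    have h2 : f K.1 K.2 = f K'.1 K'.2 := by
      ext s
      have := DFunLike.congr_fun h1 (e s)
      simpa using this
    apply Subtype.ext
    apply SetLike.coe_injective
    rw [hf K.1 K.2, hf K'.1 K'.2, h2]
  refine (Nat.card_le_card_of_injective T hT).trans ?_
  rw [Nat.card_fun]
  simp [mul_comm]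
end

section
/- Let G be a group generated by n elements and let d ≥ 1. Then the number of subgroups of G of index d is finite and is at most d·(d!)^{n−1}. -/
theorem exists_pointed_equiv {G : Type*} [Group G] {m : ℕ} (H : Subgroup G)
    (hH : H.index = m + 1) :
    ∃ e : (G ⧸ H) ≃ Option (Fin m), e ((1 : G) : G ⧸ H) = none := by
  have h1 : Nat.card (G ⧸ H) = Nat.card (Option (Fin m)) := by
    have : Nat.card (G ⧸ H) = m + 1 := hH
    rw [this]; simp
  have : Finite (G ⧸ H) := Nat.finite_of_card_ne_zero (by rw [h1]; simp)
  obtain ⟨e⟩ := (Finite.card_eq (α := G ⧸ H) (β := Option (Fin m))).1 h1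
  exact ⟨e.trans (Equiv.swap (e ((1 : G) : G ⧸ H)) none), by simp⟩

/-- The action of `G` on the cosets of `H`, transported along an equivalence. -/
noncomputable def cosetHom {G X : Type*} [Group G] (H : Subgroup G) (e : (G ⧸ H) ≃ X) :
    G →* Equiv.Perm X :=
  (e.permCongrHom : Equiv.Perm (G ⧸ H) →* Equiv.Perm X).comp (MulAction.toPermHom G (G ⧸ H))

theorem cosetHom_apply {G X : Type*} [Group G] (H : Subgroup G) (e : (G ⧸ H) ≃ X) (g : G)
    (x : X) (hx : e ((1 : G) : G ⧸ H) = x) : cosetHom H e g x = e (g : G ⧸ H) := by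
  subst hx
  have : g • ((1 : G) : G ⧸ H) = (g : G ⧸ H) := by
    rw [MulAction.Quotient.smul_coe]; simp
  simp [cosetHom, Equiv.permCongrHom, Equiv.permCongr_apply, this]

/-- A group generated by `n` elements has only finitely many subgroups of
index `d`, and their number is at most `d·(d!)^(n−1)`. -/
theorem card_subgroups_of_index_le
    {G : Type*} [Group G] {n d : ℕ} (hd : 1 ≤ d)
    (T : Finset G) (hT : T.card = n) (hgen : Subgroup.closure (T : Set G) = ⊤) :
    {H : Subgroup G | H.index = d}.Finite ∧
      Nat.card {H : Subgroup G // H.index = d} ≤ d * (Nat.factorial d) ^ (n - 1) := by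
  classical
  obtain ⟨m, rfl⟩ : ∃ m, d = m + 1 := ⟨d - 1, by omega⟩
  let S := {H : Subgroup G // H.index = m + 1}
  choose e he using fun H : S => exists_pointed_equiv H.1 H.2
  let E : (p : S × Equiv.Perm (Fin m)) → (G ⧸ p.1.1) ≃ Option (Fin m) :=
    fun p => (e p.1).trans p.2.optionCongr
  have hE : ∀ p, E p ((1 : G) : G ⧸ p.1.1) = none := fun p => by simp [E, he]
  let F : S × Equiv.Perm (Fin m) → (T → Equiv.Perm (Option (Fin m))) :=
    fun p t => cosetHom p.1.1 (E p) t
  have hF : Function.Injective F := by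
    intro p q hpq
    have hom : cosetHom p.1.1 (E p) = cosetHom q.1.1 (E q) := by
      apply MonoidHom.eq_of_eqOn_dense hgen
      intro t ht
      exact congrFun hpq ⟨t, ht⟩
    have key : ∀ g : G, E p (g : G ⧸ p.1.1) = E q (g : G ⧸ q.1.1) := by
      intro g
      rw [← cosetHom_apply _ _ g none (hE p), ← cosetHom_apply _ _ g none (hE q), hom]
    have mem : ∀ (r : S × Equiv.Perm (Fin m)) (g : G),
        g ∈ r.1.1 ↔ E r (g : G ⧸ r.1.1) = none := by
      intro r g
      rw [← hE r, (E r).injective.eq_iff, eq_comm, QuotientGroup.eq]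
      simp
    obtain ⟨H, σ⟩ := p
    obtain ⟨K, τ⟩ := q
    have hHK : H = K := by
      apply Subtype.ext
      ext g
      have h1 := mem (H, σ) g
      have h2 := mem (K, τ) g
      have h3 := key g
      rw [h3] at h1
      exact h1.trans h2.symm
    subst hHK
    have : σ = τ := by
      apply Equiv.optionCongr_injective
      ext1 x
      obtain ⟨y, rfl⟩ := (e H).surjective x
      obtain ⟨g, rfl⟩ := QuotientGroup.mk_surjective y
      exact key g
    rw [this]
  have hfinP : Finite (S × Equiv.Perm (Fin m)) := Finite.of_injective F hF
  have hfin : Finite S := Finite.prod_left (Equiv.Perm (Fin m))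
  refine ⟨Set.finite_coe_iff.mp hfin, ?_⟩
  have hcard := Nat.card_le_card_of_injective F hF
  have h1 : Nat.card S * m.factorial ≤ (m + 1).factorial ^ n := by
    simpa [Nat.card_prod, Fintype.card_perm, Nat.card_fun, hT] using hcard
  change Nat.card S ≤ _
  rcases Nat.eq_zero_or_pos n with rfl | hn
  · have : Nat.card S ≤ 1 := by
      have := Nat.factorial_pos m
      simp at h1
      nlinarith
    simp
    omega
  · obtain ⟨k, rfl⟩ : ∃ k, n = k + 1 := ⟨n - 1, by omega⟩
    apply Nat.le_of_mul_le_mul_right _ (Nat.factorial_pos m)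
    refine h1.trans (le_of_eq ?_)
    rw [pow_succ, Nat.add_sub_cancel]
    nth_rewrite 2 [Nat.factorial_succ]
    ring
end
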